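/- arXiv:1209.0533 — 2 statements merged into one kernel-verified Lean document; each statement's English description precedes it below -/
import Mathlib

section
/- For every natural number n, the Genocchi number G_n = 2(1 - 2^n)·B_n is an integer, where B_n denotes the n-th Bernoulli number. -/
/-- The Genocchi number `G n = 2 * (1 - 2 ^ n) * B n`, where `B n` is the `n`-th
Bernoulli number (with the convention `B 1 = -1/2`, i.e. the e.g.f. `t / (e^t - 1)`). -/
noncomputable def genocchi (n : ℕ) : ℚ := 2 * (1 - 2 ^ n) * bernoulli n

/-- A consequence of Fermat's little theorem. -/
theorem Nat.Prime.dvd_two_mul_one_sub_two_pow {p n : ℕ} (hp : p.Prime) (hn : p - 1 ∣ n) :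
    (p : ℤ) ∣ 2 * (1 - 2 ^ n) := by
  obtain rfl | hp2 := eq_or_ne p 2
  · exact dvd_mul_right _ _
  have := Fact.mk hp
  have h2 : (2 : ZMod p) ≠ 0 := by
    intro h
    have h' : ((2 : ℕ) : ZMod p) = 0 := by exact_mod_cast h
    rw [ZMod.natCast_eq_zero_iff] at h'
    exact hp2 ((Nat.prime_dvd_prime_iff_eq hp Nat.prime_two).mp h')
  obtain ⟨m, rfl⟩ := hn
  rw [← ZMod.intCast_zmod_eq_zero_iff_dvd]
  push_cast
  rw [pow_mul, ZMod.pow_card_sub_one_eq_one h2, one_pow, sub_self, mul_zero]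

/-- Every Genocchi number is an integer. -/
theorem genocchi_isInt (n : ℕ) : ∃ g : ℤ, (g : ℚ) = genocchi n := by
  suffices h : genocchi n ∈ (Int.castRingHom ℚ).range from h
  unfold genocchi
  obtain ⟨k, rfl⟩ | hodd := (Nat.even_or_odd n).imp_left even_iff_two_dvd.mp
  · obtain ⟨b, hb⟩ := Bernoulli.vonStaudt_clausen k
    rw [eq_sub_of_add_eq hb.symm, mul_sub, Finset.mul_sum]
    refine sub_mem ⟨2 * (1 - 2 ^ (2 * k)) * b, by simp⟩ (sum_mem fun p hp => ?_)
    obtain ⟨hp, hdvd⟩ := (Finset.mem_filter.mp hp).2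
    obtain ⟨m, hm⟩ := hp.dvd_two_mul_one_sub_two_pow hdvd
    have hp0 : (p : ℚ) ≠ 0 := Nat.cast_ne_zero.mpr hp.ne_zero
    have hm' : (2 * (1 - 2 ^ (2 * k)) : ℚ) = p * m := by exact_mod_cast hm
    refine ⟨m, ?_⟩
    rw [hm', mul_one_div, mul_div_cancel_left₀ _ hp0, eq_intCast]
  · obtain rfl | hn := eq_or_ne n 1
    · exact ⟨1, by norm_num [bernoulli_one]⟩
    · rw [bernoulli_eq_zero_of_odd hodd (by have := hodd.pos; omega), mul_zero]
      exact zero_mem _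
end

section
/- The number of bits in the numerator of B_{2n} is Θ(n·log n); precisely, there exist constants c₁, c₂ > 0 and a threshold N such that for all n ≥ N, c₁·n·log n ≤ log|numerator(B_{2n})| ≤ c₂·n·log n, where numerator denotes the numerator of a rational number in lowest terms and log is the natural logarithm. -/
open Real

/-- `|B_{2k}| (2π)^{2k} / (2 (2k)!) = ∑ 1 / n^{2k}`. -/
theorem hasSum_abs_bernoulli_two_mul {k : ℕ} (hk : k ≠ 0) :
    HasSum (fun n : ℕ => 1 / (n : ℝ) ^ (2 * k))
      (|(bernoulli (2 * k) : ℝ)| * (2 * π) ^ (2 * k) / (2 * (2 * k).factorial)) := by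
  have h := hasSum_zeta_nat hk
  have habs := abs_of_nonneg (h.nonneg fun n => by positivity)
  rw [← habs] at h
  convert h using 1
  have h2 : (2 : ℝ) ^ (2 * k) = 2 ^ (2 * k - 1) * 2 := by
    rw [← pow_succ]
    congr 1
    omega
  rw [abs_div, abs_mul, abs_mul, abs_mul, abs_pow, abs_neg, abs_one, one_pow, Nat.abs_cast,
    abs_of_pos (show (0 : ℝ) < 2 ^ (2 * k - 1) by positivity),
    abs_of_pos (show (0 : ℝ) < π ^ (2 * k) by positivity), mul_pow, h2]
  field_simp

theorem two_mul_factorial_le_abs_bernoulli_two_mul {k : ℕ} (hk : k ≠ 0) :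
    2 * ((2 * k).factorial : ℝ) ≤ |(bernoulli (2 * k) : ℝ)| * (2 * π) ^ (2 * k) := by
  have h := le_hasSum (hasSum_abs_bernoulli_two_mul hk) 1 fun n _ => by positivity
  rw [Nat.cast_one, one_pow, div_one, le_div_iff₀ (by positivity), one_mul] at h
  exact h

theorem abs_bernoulli_two_mul_le {k : ℕ} (hk : k ≠ 0) :
    |(bernoulli (2 * k) : ℝ)| * (2 * π) ^ (2 * k) ≤ 4 * ((2 * k).factorial : ℝ) := by
  have h : |(bernoulli (2 * k) : ℝ)| * (2 * π) ^ (2 * k) / (2 * (2 * k).factorial) ≤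
      π ^ 2 / 6 := by
    refine hasSum_le (fun n => ?_) (hasSum_abs_bernoulli_two_mul hk) hasSum_zeta_two
    rcases Nat.eq_zero_or_pos n with rfl | hn
    · simp [hk]
    · have hn' : (1 : ℝ) ≤ n := by exact_mod_cast hn
      exact one_div_le_one_div_of_le (by positivity) (pow_le_pow_right₀ hn' (by omega))
  have hπ : π ^ 2 / 6 ≤ 2 := by nlinarith [pi_lt_d2, pi_pos]
  have h' := h.trans hπ
  rw [div_le_iff₀ (by positivity)] at h'
  linarith

theorem den_bernoulli_two_mul_dvd_primorial (k : ℕ) :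
    (bernoulli (2 * k)).den ∣ primorial (2 * k + 1) := by
  obtain ⟨z, hz⟩ := Bernoulli.vonStaudt_clausen k
  rw [eq_sub_of_add_eq hz.symm]
  refine (Rat.sub_den_dvd _ _).trans ?_
  rw [Rat.den_intCast, one_mul]
  refine (Finset.Rat.den_sum_dvd_prod_den _ _).trans ?_
  rw [Finset.prod_congr rfl (g := fun p : ℕ => p) fun p hp => ?_]
  · exact Finset.prod_dvd_prod_of_subset _ _ _
      (Finset.monotone_filter_right _ fun p _ hp => hp.1)
  · have hp0 := (Finset.mem_filter.mp hp).2.1.pos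
    simp [Rat.inv_natCast_den_of_pos hp0]

theorem den_bernoulli_two_mul_le (k : ℕ) : (bernoulli (2 * k)).den ≤ 4 ^ (2 * k + 1) :=
  (Nat.le_of_dvd (primorial_pos _) (den_bernoulli_two_mul_dvd_primorial k)).trans
    (primorial_le_four_pow _)

theorem Rat.abs_num_eq_abs_mul_den (q : ℚ) : (|q.num| : ℝ) = |(q : ℝ)| * q.den := by
  rw [← Nat.abs_cast q.den, ← abs_mul]
  exact_mod_cast congrArg (fun x : ℚ => |x|) q.mul_den_eq_num.symm

theorem le_log_abs_num_bernoulli_two_mul {k : ℕ} (hk : k ≠ 0) :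
    2 * k * log k - 2 * k * (1 + log π) ≤ log (|(bernoulli (2 * k)).num| : ℝ) := by
  have hB := two_mul_factorial_le_abs_bernoulli_two_mul hk
  have hpos : 0 < |(bernoulli (2 * k) : ℝ)| :=
    pos_of_mul_pos_left (lt_of_lt_of_le (by positivity) hB) (by positivity)
  have hlog := log_le_log (by positivity) hB
  rw [log_mul two_ne_zero (by positivity), log_mul hpos.ne' (by positivity), log_pow,
    log_mul two_ne_zero pi_ne_zero] at hlog
  have hst := Stirling.le_log_factorial_stirling (n := 2 * k) (by omega)
  push_cast at hst hlog
  have hk0 : (k : ℝ) ≠ 0 := by exact_mod_cast hk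
  have hk1 : (1 : ℝ) ≤ k := by exact_mod_cast Nat.one_le_iff_ne_zero.mpr hk
  rw [log_mul two_ne_zero hk0, log_mul two_ne_zero pi_ne_zero] at hst
  have h2 : 0 ≤ log 2 := log_nonneg (by norm_num)
  have hlogk : 0 ≤ log (k : ℝ) := log_nonneg hk1
  have hlogpi : 0 ≤ log π := log_nonneg (by linarith [pi_gt_three])
  have hle : log |(bernoulli (2 * k) : ℝ)| ≤ log (|(bernoulli (2 * k)).num| : ℝ) := by
    rw [Rat.abs_num_eq_abs_mul_den]
    refine log_le_log hpos (le_mul_of_one_le_right hpos.le ?_)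
    exact_mod_cast (bernoulli (2 * k)).den_pos
  linarith

theorem log_abs_num_bernoulli_two_mul_le {k : ℕ} (hk : k ≠ 0) :
    log (|(bernoulli (2 * k)).num| : ℝ) ≤ 2 * k * log (2 * k) + (2 * k + 2) * log 4 := by
  have hB := two_mul_factorial_le_abs_bernoulli_two_mul hk
  have hpos : 0 < |(bernoulli (2 * k) : ℝ)| :=
    pos_of_mul_pos_left (lt_of_lt_of_le (by positivity) hB) (by positivity)
  have hle : |(bernoulli (2 * k) : ℝ)| ≤ 4 * (2 * k : ℝ) ^ (2 * k) := by
    have hfac : ((2 * k).factorial : ℝ) ≤ (2 * k : ℝ) ^ (2 * k) := by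
      exact_mod_cast Nat.factorial_le_pow (2 * k)
    have h1 : (1 : ℝ) ≤ (2 * π) ^ (2 * k) := one_le_pow₀ (by linarith [pi_gt_three])
    linarith [le_mul_of_one_le_right hpos.le h1, abs_bernoulli_two_mul_le hk]
  have hden : ((bernoulli (2 * k)).den : ℝ) ≤ 4 ^ (2 * k + 1) := by
    exact_mod_cast den_bernoulli_two_mul_le k
  have hden0 : (0 : ℝ) < (bernoulli (2 * k)).den := by
    exact_mod_cast (bernoulli (2 * k)).den_pos
  calc log (|(bernoulli (2 * k)).num| : ℝ)
      ≤ log ((4 * (2 * k : ℝ) ^ (2 * k)) * 4 ^ (2 * k + 1)) := by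
        rw [Rat.abs_num_eq_abs_mul_den]
        exact log_le_log (by positivity) (by gcongr)
    _ = 2 * k * log (2 * k) + (2 * k + 2) * log 4 := by
        rw [log_mul (by positivity) (by positivity), log_mul (by positivity) (by positivity),
          log_pow, log_pow]
        push_cast
        ring

/-- The number of bits in the numerator of `B_{2n}` is `Θ(n log n)`: there are
constants `c₁, c₂ > 0` and a threshold `N` such that for all `n ≥ N`,
`c₁ n log n ≤ log |numerator (B_{2n})| ≤ c₂ n log n`. -/
theorem log_abs_num_bernoulli_two_mul :
    ∃ c₁ > (0 : ℝ), ∃ c₂ > (0 : ℝ), ∃ N : ℕ, ∀ n : ℕ, N ≤ n →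
      c₁ * n * Real.log n ≤ Real.log (|(bernoulli (2 * n)).num| : ℝ) ∧
      Real.log (|(bernoulli (2 * n)).num| : ℝ) ≤ c₂ * n * Real.log n := by
  refine ⟨1, one_pos, 8, by norm_num, max 4 ⌈exp (2 * (1 + log π))⌉₊, fun n hn => ?_⟩
  have hn4 : 4 ≤ n := (le_max_left _ _).trans hn
  have hn0 : n ≠ 0 := by omega
  have hn4' : (4 : ℝ) ≤ n := by exact_mod_cast hn4
  have hexp : exp (2 * (1 + log π)) ≤ n := Nat.ceil_le.mp ((le_max_right _ _).trans hn)
  have hlog : 2 * (1 + log π) ≤ log n := (le_log_iff_exp_le (by positivity)).mpr hexp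
  have hlog4 : log 4 ≤ log n := log_le_log (by norm_num) hn4'
  have hlog2 : log 2 ≤ log n := log_le_log (by norm_num) (by linarith)
  constructor
  · nlinarith [le_log_abs_num_bernoulli_two_mul hn0]
  · have h := log_abs_num_bernoulli_two_mul_le hn0
    rw [log_mul two_ne_zero (by positivity)] at h
    have h2 : (2 * n + 2 : ℝ) * log 4 ≤ (4 * n) * log n :=
      mul_le_mul (by linarith) hlog4 (log_nonneg (by norm_num)) (by positivity)
    have h3 : (n : ℝ) * log 2 ≤ n * log n := by gcongr
    linarith
end
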